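/- arXiv:2009.01988 — 5 statements merged into one kernel-verified Lean document; each statement's English description precedes it below -/
import Mathlib

section
/- Let N ≥ 1 be an integer and set τ_N = N·(N!)^{−1/N}. Then for every real x ≥ 0, the cumulative distribution function of the Gamma distribution of shape N and rate N satisfies P(X ≤ x) ≥ (1 − e^{−τ_N x})^N; equivalently, (1/(N−1)!)·∫_0^{N x} t^{N−1} e^{−t} dt ≥ (1 − e^{−τ_N x})^N. -/
open MeasureTheory ProbabilityTheory Real

/-- A function on `[0, ∞)` that vanishes at both ends and whose derivative stays nonpositive once
it has been negative is nonnegative. -/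
theorem nonneg_of_deriv_single_crossing {h h' : ℝ → ℝ} (hd : ∀ y, HasDerivAt h (h' y) y)
    (h0 : h 0 = 0) (hlim : Filter.Tendsto h Filter.atTop (nhds 0))
    (hc : ∀ s t, 0 < s → s ≤ t → h' s < 0 → h' t ≤ 0) {x : ℝ} (hx : 0 ≤ x) : 0 ≤ h x := by
  by_contra! hneg
  have hx0 : 0 < x := by
    rcases hx.lt_or_eq with h1 | h1
    · exact h1
    · rw [← h1, h0] at hneg
      exact absurd hneg (lt_irrefl _)
  have hcont : Continuous h := continuous_iff_continuousAt.2 fun y => (hd y).continuousAt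
  obtain ⟨s, hs, hslope⟩ := exists_hasDerivAt_eq_slope h h' hx0 hcont.continuousOn
    fun y _ => hd y
  have hs' : h' s < 0 := by
    rw [hslope, h0]
    exact div_neg_of_neg_of_pos (by linarith) (by linarith)
  have hanti : AntitoneOn h (Set.Ici s) := by
    refine antitoneOn_of_hasDerivWithinAt_nonpos (convex_Ici s) hcont.continuousOn
      (fun y _ => (hd y).hasDerivWithinAt) fun y hy => ?_
    rw [interior_Ici] at hy
    exact hc s y hs.1 hy.le hs'
  have hle : (0 : ℝ) ≤ h x := by
    refine le_of_tendsto hlim ?_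
    filter_upwards [Filter.eventually_ge_atTop x] with y hy
    exact hanti hs.2.le (hs.2.le.trans hy) hy
  linarith

theorem integral_exp_neg_mul_zero_one {s : ℝ} (hs : 0 < s) :
    ∫ u in Set.Ioc (0 : ℝ) 1, exp (-(s * u)) = (1 - exp (-s)) / s := by
  rw [← intervalIntegral.integral_of_le zero_le_one]
  have h := intervalIntegral.integral_comp_mul_left (a := 0) (b := 1) (fun v => exp v)
    (neg_ne_zero.2 hs.ne')
  simp only [neg_mul] at h
  rw [h, integral_exp, mul_zero, mul_one, neg_zero, exp_zero, smul_eq_mul, inv_neg]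
  field_simp
  ring

/-- The power mean inequality for `u ↦ exp (-u)` on `[0, 1]`. -/
theorem one_sub_exp_neg_div_rpow_le {s t : ℝ} (hs : 0 < s) (hst : s ≤ t) :
    ((1 - exp (-s)) / s) ^ (t / s) ≤ (1 - exp (-t)) / t := by
  have hprob : IsProbabilityMeasure (volume.restrict (Set.Ioc (0 : ℝ) 1)) := ⟨by simp⟩
  have hint : ∀ r : ℝ, Integrable (fun u => exp (-(r * u)))
      (volume.restrict (Set.Ioc (0 : ℝ) 1)) := fun r =>
    ((by fun_prop : Continuous fun u : ℝ => exp (-(r * u))).integrableOn_Icc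
      (a := 0) (b := 1)).mono_set Set.Ioc_subset_Icc_self
  have hpow : ∀ u : ℝ, exp (-(s * u)) ^ (t / s) = exp (-(t * u)) := fun u => by
    rw [← exp_mul]
    congr 1
    field_simp
  have hp : 1 ≤ t / s := (one_le_div hs).2 hst
  have h := (convexOn_rpow hp).map_integral_le (μ := volume.restrict (Set.Ioc (0 : ℝ) 1))
    (f := fun u => exp (-(s * u)))
    (continuous_rpow_const (by positivity)).continuousOn isClosed_Ici
    (ae_of_all _ fun u => (exp_pos _).le) (hint s)
    (by simpa only [Function.comp_def, hpow] using hint t)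
  simpa only [hpow, integral_exp_neg_mul_zero_one hs,
    integral_exp_neg_mul_zero_one (hs.trans_le hst)] using h

/-- The lower incomplete gamma integral divided by `n!` tends to `1`. -/
theorem tendsto_integral_pow_mul_exp_neg (n : ℕ) :
    Filter.Tendsto (fun y : ℝ => 1 / (n.factorial : ℝ) * ∫ t in (0 : ℝ)..y, t ^ n * exp (-t))
      Filter.atTop (nhds 1) := by
  have hn : (0 : ℝ) < n + 1 := by positivity
  have hfun : (fun x : ℝ => exp (-x) * x ^ ((n : ℝ) + 1 - 1)) = fun x => x ^ n * exp (-x) := by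
    ext x
    rw [add_sub_cancel_right, rpow_natCast, mul_comm]
  have hI := GammaIntegral_convergent hn
  have hG := Gamma_eq_integral hn
  rw [hfun] at hI
  rw [hfun, Gamma_nat_eq_factorial] at hG
  have h := (intervalIntegral_tendsto_integral_Ioi 0 hI Filter.tendsto_id).const_mul
    (1 / (n.factorial : ℝ))
  rw [← hG, one_div_mul_cancel (by positivity)] at h
  exact h

/-- Alzer's inequality for the regularized incomplete gamma function of integer shape. -/
theorem one_sub_exp_pow_le_integral (n : ℕ) {c : ℝ} (hc : 0 < c)
    (hcn : c ^ (n + 1) = 1 / ((n + 1).factorial : ℝ)) {y : ℝ} (hy : 0 ≤ y) :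
    (1 - exp (-(c * y))) ^ (n + 1) ≤
      1 / (n.factorial : ℝ) * ∫ t in (0 : ℝ)..y, t ^ n * exp (-t) := by
  let m : ℝ → ℝ := fun s => (1 - exp (-s)) / s
  have hm : ∀ s, 0 < s → 0 ≤ m s := fun s hs =>
    div_nonneg (sub_nonneg.2 (exp_le_one_iff.2 (by linarith))) hs.le
  have hfac : 1 / (n.factorial : ℝ) = (n + 1) * c ^ (n + 1) := by
    rw [hcn, Nat.factorial_succ]
    push_cast
    field_simp
  have hd : ∀ y, HasDerivAt (fun y => 1 / (n.factorial : ℝ) *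
        (∫ t in (0 : ℝ)..y, t ^ n * exp (-t)) - (1 - exp (-(c * y))) ^ (n + 1))
      (1 / (n.factorial : ℝ) * (y ^ n * exp (-y)) -
        (n + 1) * (1 - exp (-(c * y))) ^ n * (exp (-(c * y)) * c)) y := by
    intro y
    have h1 : HasDerivAt (fun u : ℝ => ∫ t in (0 : ℝ)..u, t ^ n * exp (-t))
        (y ^ n * exp (-y)) y :=
      ((by fun_prop : Continuous fun t : ℝ => t ^ n * exp (-t)).integral_hasStrictDerivAt
        0 y).hasDerivAt
    have h2 : HasDerivAt (fun y => 1 - exp (-(c * y))) (exp (-(c * y)) * c) y := by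
      have := (((hasDerivAt_id y).const_mul c).neg.exp).const_sub 1
      simpa using this
    have h3 := h2.pow (n + 1)
    simp only [Nat.add_sub_cancel, Nat.cast_add, Nat.cast_one] at h3
    exact (h1.const_mul _).sub h3
  have hfactor : ∀ y : ℝ, 0 < y → 1 / (n.factorial : ℝ) * (y ^ n * exp (-y)) -
        (n + 1) * (1 - exp (-(c * y))) ^ n * (exp (-(c * y)) * c) =
      (n + 1) * c * exp (-(c * y)) * (c * y) ^ n *
        (exp (-((1 - c) * y)) - m (c * y) ^ n) := by
    intro y hy
    have h1 : 1 - exp (-(c * y)) = c * y * m (c * y) := by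
      simp only [m]
      field_simp
    have h2 : exp (-y) = exp (-(c * y)) * exp (-((1 - c) * y)) := by
      rw [← exp_add]
      congr 1
      ring
    rw [h1, h2, hfac]
    generalize m (c * y) = v
    ring
  have hlim := (tendsto_integral_pow_mul_exp_neg n).sub
    ((((tendsto_exp_neg_atTop_nhds_zero.comp
      (Filter.tendsto_id.const_mul_atTop hc)).const_sub 1)).pow (n + 1))
  rw [sub_zero, one_pow, sub_self] at hlim
  have key := nonneg_of_deriv_single_crossing hd (by simp) hlim ?_ hy
  · exact sub_nonneg.1 key
  intro s t hs hst hneg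
  have ht := hs.trans_le hst
  rw [hfactor s hs] at hneg
  rw [hfactor t ht]
  have hlt : exp (-((1 - c) * s)) ≤ m (c * s) ^ n := by
    by_contra! hcon
    have : 0 ≤ (n + 1) * c * exp (-(c * s)) * (c * s) ^ n *
        (exp (-((1 - c) * s)) - m (c * s) ^ n) :=
      mul_nonneg (by positivity) (sub_nonneg.2 hcon.le)
    linarith
  refine mul_nonpos_of_nonneg_of_nonpos (by positivity) (sub_nonpos.2 ?_)
  have hms := hm (c * s) (by positivity)
  calc exp (-((1 - c) * t)) = exp (-((1 - c) * s)) ^ (t / s) := by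
        rw [← exp_mul]
        congr 1
        field_simp
    _ ≤ (m (c * s) ^ n) ^ (t / s) := rpow_le_rpow (exp_pos _).le hlt (by positivity)
    _ = (m (c * s) ^ (t / s)) ^ n := by
        rw [← rpow_natCast, ← rpow_natCast, ← rpow_mul hms, ← rpow_mul hms,
          mul_comm (n : ℝ)]
    _ ≤ m (c * t) ^ n := by
        refine pow_le_pow_left₀ (rpow_nonneg hms _) ?_ n
        have h := one_sub_exp_neg_div_rpow_le (mul_pos hc hs)
          (mul_le_mul_of_nonneg_left hst hc.le)
        rwa [mul_div_mul_left _ _ hc.ne'] at h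

theorem gammaMeasure_Iic_toReal_eq_integral (n : ℕ) {r x : ℝ} (hr : 0 < r) (hx : 0 ≤ x) :
    ((gammaMeasure ((n : ℝ) + 1) r) (Set.Iic x)).toReal =
      1 / (n.factorial : ℝ) * ∫ t in (0 : ℝ)..(r * x), t ^ n * exp (-t) := by
  have hn : (0 : ℝ) < n + 1 := by positivity
  have hprob := isProbabilityMeasure_gammaMeasure hn hr
  have hsub := intervalIntegral.smul_integral_comp_mul_left (a := 0) (b := x)
    (fun t : ℝ => t ^ n * exp (-t)) r
  rw [mul_zero] at hsub
  rw [← measureReal_def, ← cdf_eq_real, cdf_gammaMeasure_eq_integral hn hr, ← hsub,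
    smul_eq_mul, ← intervalIntegral.integral_const_mul, ← intervalIntegral.integral_const_mul,
    intervalIntegral.integral_of_le hx, ← integral_Icc_eq_integral_Ioc, ← Set.Ici_inter_Iic,
    Set.inter_comm, ← setIntegral_indicator measurableSet_Ici]
  congr 1
  ext t
  rw [gammaPDFReal, Set.indicator_apply]
  simp only [Set.mem_Ici]
  split_ifs with ht
  · rw [Gamma_nat_eq_factorial, add_sub_cancel_right, rpow_natCast, ← Nat.cast_succ,
      rpow_natCast, mul_pow, pow_succ]
    ring
  · rfl


/-- **Alzer's inequality.** For an integer `N ≥ 1` and `τ_N = N * (N!)^(-1/N)`,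
the CDF of the Gamma distribution of shape `N` and rate `N` satisfies, for every `x ≥ 0`,
`P(X ≤ x) ≥ (1 - exp (-τ_N * x)) ^ N`; equivalently,
`(1/(N-1)!) * ∫_0^{N x} t^(N-1) e^(-t) dt ≥ (1 - exp (-τ_N * x)) ^ N`. -/
theorem gamma_cdf_lower_bound
    (N : ℕ) (hN : 1 ≤ N) (x : ℝ) (hx : 0 ≤ x) :
    ((gammaMeasure N N) (Set.Iic x)).toReal ≥
        (1 - Real.exp (-((N : ℝ) * ((N.factorial : ℝ) ^ (-(1 : ℝ) / N)) * x))) ^ N ∧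
    (1 / ((N - 1).factorial : ℝ)) * ∫ t in (0 : ℝ)..((N : ℝ) * x), t ^ (N - 1) * Real.exp (-t) ≥
        (1 - Real.exp (-((N : ℝ) * ((N.factorial : ℝ) ^ (-(1 : ℝ) / N)) * x))) ^ N := by
  obtain ⟨n, rfl⟩ : ∃ n, N = n + 1 := ⟨N - 1, by omega⟩
  have hf : (0 : ℝ) < ((n + 1).factorial : ℝ) := by positivity
  have hcn : (((n + 1).factorial : ℝ) ^ (-(1 : ℝ) / (n + 1 : ℕ))) ^ (n + 1) =
      1 / ((n + 1).factorial : ℝ) := by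
    rw [← rpow_natCast, ← rpow_mul hf.le, div_mul_cancel₀ _ (by positivity), rpow_neg_one,
      one_div]
  have hmain := one_sub_exp_pow_le_integral n (rpow_pos_of_pos hf _) hcn
    (y := ((n + 1 : ℕ) : ℝ) * x) (by positivity)
  rw [← mul_assoc, mul_comm (_ ^ _ : ℝ) ((n + 1 : ℕ) : ℝ)] at hmain
  refine ⟨?_, hmain⟩
  have hmeas := gammaMeasure_Iic_toReal_eq_integral n (r := ((n + 1 : ℕ) : ℝ)) (by positivity) hx
  rw [← Nat.cast_succ] at hmeas
  rw [hmeas]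
  exact hmain
end

section
/- Let D > 0, let y₀ ∈ ℝ² with u := ‖y₀‖ satisfying 0 < u < D, and let g : (0, ∞) → [0, ∞) be measurable. Then ∫_{{x ∈ ℝ² : ‖x‖ ≤ D, ‖x − y₀‖ > D}} g(‖x‖) dx = 2·∫_{D−u}^{D} g(r)·(π − arccos((u² + r² − D²)/(2·u·r)))·r dr. -/
open MeasureTheory Real
open scoped ENNReal

theorem setOf_cos_lt_inter_Ioo {c : ℝ} (h₁ : -1 ≤ c) (h₂ : c ≤ 1) :
    {θ | cos θ < c} ∩ Set.Ioo (-π) π = Set.Ioo (-π) (-arccos c) ∪ Set.Ioo (arccos c) π := by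
  have key : ∀ θ ∈ Set.Ioo (-π) π, cos θ < c ↔ arccos c < |θ| := by
    intro θ hθ
    have hmem : |θ| ∈ Set.Icc 0 π := ⟨abs_nonneg θ, (abs_lt.2 hθ).le⟩
    rw [← strictAntiOn_cos.lt_iff_gt hmem ⟨arccos_nonneg c, arccos_le_pi c⟩,
      cos_arccos h₁ h₂, cos_abs]
  have h₀ := arccos_nonneg c
  ext θ
  simp only [Set.mem_inter_iff, Set.mem_ofPred_eq, Set.mem_union, Set.mem_Ioo]
  constructor
  · rintro ⟨hc, hθ⟩
    rcases lt_abs.1 ((key θ hθ).1 hc) with h | h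
    · exact Or.inr ⟨h, hθ.2⟩
    · exact Or.inl ⟨hθ.1, by linarith⟩
  · rintro (h | h)
    · have hθ : θ ∈ Set.Ioo (-π) π := ⟨h.1, by linarith [pi_pos, h.2]⟩
      exact ⟨(key θ hθ).2 (lt_abs.2 (Or.inr (by linarith [h.2]))), hθ⟩
    · have hθ : θ ∈ Set.Ioo (-π) π := ⟨by linarith [pi_pos, h.1], h.2⟩
      exact ⟨(key θ hθ).2 (lt_abs.2 (Or.inl h.1)), hθ⟩

theorem volume_setOf_cos_lt_inter_Ioo {c : ℝ} (h₂ : c ≤ 1) :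
    volume ({θ | cos θ < c} ∩ Set.Ioo (-π) π) = 2 * ENNReal.ofReal (π - arccos c) := by
  rcases lt_or_ge c (-1) with h₁ | h₁
  · have : {θ | cos θ < c} = ∅ := by
      ext θ
      simpa using h₁.le.trans (neg_one_le_cos θ)
    simp [this, arccos_of_le_neg_one h₁.le]
  · have hdisj : Disjoint (Set.Ioo (-π) (-arccos c)) (Set.Ioo (arccos c) π) :=
      Set.disjoint_left.2 fun θ h h' => by linarith [h.2, h'.1, arccos_nonneg c]
    rw [setOf_cos_lt_inter_Ioo h₁ h₂, measure_union hdisj measurableSet_Ioo, volume_Ioo,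
      volume_Ioo, two_mul, show -arccos c - -π = π - arccos c by ring]

theorem exists_linearIsometryEquiv_complex_apply_norm (y : EuclideanSpace ℝ (Fin 2)) :
    ∃ e : ℂ ≃ₗᵢ[ℝ] EuclideanSpace ℝ (Fin 2), e (‖y‖ : ℂ) = y := by
  set b := Complex.orthonormalBasisOneI.repr
  refine ⟨(rotation (Circle.exp (Complex.arg (b.symm y)))).trans b, ?_⟩
  rw [LinearIsometryEquiv.trans_apply, rotation_apply, Circle.coe_exp, ← b.symm.norm_map y,
    mul_comm, Complex.norm_mul_exp_arg_mul_I, b.apply_symm_apply]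

theorem lt_norm_polarCoord_symm_sub_iff {D u : ℝ} (hD : 0 < D) (hu : 0 < u) {r : ℝ} (hr : 0 < r)
    (θ : ℝ) : D < ‖Complex.polarCoord.symm (r, θ) - u‖ ↔
      cos θ < (u ^ 2 + r ^ 2 - D ^ 2) / (2 * u * r) := by
  have hsq : ‖Complex.polarCoord.symm (r, θ) - u‖ ^ 2 = r ^ 2 + u ^ 2 - 2 * u * r * cos θ := by
    rw [Complex.sq_norm, Complex.normSq_apply, Complex.polarCoord_symm_apply]
    simp [Complex.cos_ofReal_re, Complex.sin_ofReal_re]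
    linear_combination r ^ 2 * sin_sq_add_cos_sq θ
  rw [lt_div_iff₀ (by positivity), ← sq_lt_sq₀ hD.le (norm_nonneg _), hsq]
  constructor <;> intro h <;> linarith

/-- For `D > 0`, `y₀ ∈ ℝ²` with `0 < u := ‖y₀‖ < D`, and measurable
`g : (0,∞) → [0,∞]`,
`∫_{‖x‖ ≤ D, ‖x - y₀‖ > D} g(‖x‖) dx
  = 2 ∫_{D-u}^{D} g(r) (π - arccos ((u² + r² - D²)/(2 u r))) r dr`. -/
theorem radial_integral_inside_ball_outside_ball_near
    (D : ℝ) (hD : 0 < D) (y₀ : EuclideanSpace ℝ (Fin 2))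
    (hu0 : 0 < ‖y₀‖) (huD : ‖y₀‖ < D)
    (g : ℝ → ℝ≥0∞) (hg : Measurable g) :
    ∫⁻ x in {x : EuclideanSpace ℝ (Fin 2) | ‖x‖ ≤ D ∧ D < ‖x - y₀‖}, g ‖x‖ =
      2 * ∫⁻ r in Set.Ioc (D - ‖y₀‖) D,
        g r * ENNReal.ofReal
          ((Real.pi - Real.arccos ((‖y₀‖ ^ 2 + r ^ 2 - D ^ 2) / (2 * ‖y₀‖ * r))) * r) := by
  obtain ⟨e, he⟩ := exists_linearIsometryEquiv_complex_apply_norm y₀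
  generalize ‖y₀‖ = u at *
  set S : Set ℂ := {z | ‖z‖ ≤ D ∧ D < ‖z - u‖} with hS
  have hSm : MeasurableSet S := by
    have h₁ : MeasurableSet {z : ℂ | ‖z‖ ≤ D} :=
      measurableSet_le measurable_norm measurable_const
    have h₂ : MeasurableSet {z : ℂ | D < ‖z - u‖} :=
      measurableSet_lt measurable_const (measurable_id.sub_const _).norm
    exact h₁.inter h₂
  have hpre : e ⁻¹' {x | ‖x‖ ≤ D ∧ D < ‖x - y₀‖} = S := by
    ext z
    simp only [hS, Set.mem_preimage, Set.mem_ofPred_eq, ← he, ← map_sub,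
      LinearIsometryEquiv.norm_map]
  rw [← e.measurePreserving.setLIntegral_comp_preimage_emb
    e.toHomeomorph.measurableEmbedding, hpre]
  simp only [LinearIsometryEquiv.norm_map]
  rw [← lintegral_indicator hSm, ← Complex.lintegral_comp_polarCoord_symm, polarCoord_target,
    Measure.volume_eq_prod, ← Measure.prod_restrict, lintegral_prod]
  swap
  · refine Measurable.aemeasurable ?_
    have hm : Measurable (Complex.polarCoord.symm : ℝ × ℝ → ℂ) := by
      have : (Complex.polarCoord.symm : ℝ × ℝ → ℂ) =
          fun p => p.1 * (Real.cos p.2 + Real.sin p.2 * Complex.I) :=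
        funext Complex.polarCoord_symm_apply
      rw [this]
      fun_prop
    have hi : Measurable (S.indicator fun z => g ‖z‖) :=
      (hg.comp measurable_norm).indicator hSm
    exact measurable_fst.ennreal_ofReal.smul (hi.comp hm)
  have inner : ∀ r ∈ Set.Ioi (0 : ℝ),
      ∫⁻ θ in Set.Ioo (-π) π, ENNReal.ofReal r •
        S.indicator (fun z => g ‖z‖) (Complex.polarCoord.symm (r, θ)) =
      (Set.Ioc (D - u) D).indicator (fun r => 2 * (g r * ENNReal.ofReal
        ((π - arccos ((u ^ 2 + r ^ 2 - D ^ 2) / (2 * u * r))) * r))) r := by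
    intro r (hr : 0 < r)
    set c := (u ^ 2 + r ^ 2 - D ^ 2) / (2 * u * r) with hc
    have hnorm (θ : ℝ) : ‖Complex.polarCoord.symm (r, θ)‖ = r := by
      rw [Complex.norm_polarCoord_symm, abs_of_pos hr]
    rcases lt_or_ge D r with hrD | hrD
    · have hmem (θ : ℝ) : Complex.polarCoord.symm (r, θ) ∉ S := fun h =>
        hrD.not_ge (hnorm θ ▸ h.1)
      simp only [Set.indicator_of_notMem (hmem _), smul_zero, lintegral_zero]
      rw [Set.indicator_of_notMem fun h => hrD.not_ge h.2]
    have hc1 : c ≤ 1 := by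
      rw [hc, div_le_one (by positivity)]
      nlinarith
    have hind (θ : ℝ) : ENNReal.ofReal r •
          S.indicator (fun z => g ‖z‖) (Complex.polarCoord.symm (r, θ)) =
        {θ | cos θ < c}.indicator (fun _ => ENNReal.ofReal r * g r) θ := by
      have hmem : Complex.polarCoord.symm (r, θ) ∈ S ↔ θ ∈ {θ | cos θ < c} := by
        simp only [hS, Set.mem_ofPred_eq, hnorm, hrD, true_and,
          lt_norm_polarCoord_symm_sub_iff hD hu0 hr, hc]
      by_cases h : θ ∈ {θ | cos θ < c}
      · rw [Set.indicator_of_mem h, Set.indicator_of_mem (hmem.2 h), hnorm, smul_eq_mul]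
      · rw [Set.indicator_of_notMem h, Set.indicator_of_notMem (mt hmem.1 h), smul_zero]
    have hcm : MeasurableSet {θ | cos θ < c} :=
      measurableSet_lt measurable_cos measurable_const
    simp_rw [hind]
    rw [lintegral_indicator_const hcm, Measure.restrict_apply hcm,
      volume_setOf_cos_lt_inter_Ioo hc1]
    rcases lt_or_ge (D - u) r with hr' | hr'
    · rw [Set.indicator_of_mem (Set.mem_Ioc.2 ⟨hr', hrD⟩),
        ENNReal.ofReal_mul (sub_nonneg.2 (arccos_le_pi c))]
      ring
    · have hc' : c ≤ -1 := by
        rw [hc, div_le_iff₀ (by positivity)]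
        nlinarith
      rw [Set.indicator_of_notMem (fun h => hr'.not_gt h.1), arccos_of_le_neg_one hc']
      simp
  rw [setLIntegral_congr_fun measurableSet_Ioi inner, setLIntegral_indicator measurableSet_Ioc,
    Set.inter_eq_left.2 fun r hr => Set.mem_Ioi.2 ((sub_pos.2 huD).trans hr.1),
    lintegral_const_mul' _ _ ENNReal.ofNat_ne_top]
end

section
/- Let D > 0, let y₀ ∈ ℝ² with u := ‖y₀‖ satisfying D ≤ u < 2D, and let g : (0, ∞) → [0, ∞) be measurable. Then ∫_{{x ∈ ℝ² : ‖x‖ ≤ D, ‖x − y₀‖ > D}} g(‖x‖) dx = 2π·∫_{0}^{D} g(r)·r dr − 2·∫_{u−D}^{D} g(r)·arccos((u² + r² − D²)/(2·u·r))·r dr. -/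
open MeasureTheory Real
open scoped ENNReal

/-- Integrating a radial function over a planar set in polar coordinates: each radius is weighted
by the angular measure of the set at that radius. -/
theorem Complex.setLIntegral_norm_eq_lintegral_angle {T : Set ℂ} (hT : MeasurableSet T)
    {g : ℝ → ℝ≥0∞} (hg : Measurable g) :
    ∫⁻ z in T, g ‖z‖ = ∫⁻ r in Set.Ioi 0, ENNReal.ofReal r *
      (g r * volume ((fun θ => Complex.polarCoord.symm (r, θ)) ⁻¹' T ∩ Set.Ioo (-π) π)) := by
  have hcont : Continuous fun p : ℝ × ℝ => Complex.polarCoord.symm p := by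
    simp only [Complex.polarCoord_symm_apply]
    fun_prop
  rw [← lintegral_indicator hT, ← Complex.lintegral_comp_polarCoord_symm,
    polarCoord_target, Measure.volume_eq_prod, ← Measure.prod_restrict, lintegral_prod]
  · refine setLIntegral_congr_fun measurableSet_Ioi fun r hr => ?_
    have hr0 : (0 : ℝ) < r := hr
    have hm : Measurable fun θ => Complex.polarCoord.symm (r, θ) :=
      hcont.measurable.comp (by fun_prop)
    have heq : ∀ θ : ℝ, T.indicator (fun z => g ‖z‖) (Complex.polarCoord.symm (r, θ)) =
        ((fun θ => Complex.polarCoord.symm (r, θ)) ⁻¹' T).indicator (fun _ => g r) θ := fun θ => by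
      simp only [Set.indicator, Set.mem_preimage, Complex.norm_polarCoord_symm, abs_of_pos hr0]
      rfl
    simp only [smul_eq_mul, heq]
    rw [lintegral_const_mul _ (measurable_const.indicator (hm hT)),
      lintegral_indicator (hm hT), setLIntegral_const, Measure.restrict_apply (hm hT)]
  · refine Measurable.aemeasurable ?_
    have h1 : Measurable fun z : ℂ => T.indicator (fun z => g ‖z‖) z :=
      (hg.comp measurable_norm).indicator hT
    exact (ENNReal.measurable_ofReal.comp measurable_fst).smul (h1.comp hcont.measurable)

/-- The angles at which the cosine is at least a nonnegative `k` fill an arc of length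
`2 * arccos k`. -/
theorem Real.volume_le_cos_inter_Ioo {k : ℝ} (hk : 0 ≤ k) :
    volume ({θ | k ≤ cos θ} ∩ Set.Ioo (-π) π) = ENNReal.ofReal (2 * arccos k) := by
  rcases le_or_gt k 1 with hk1 | hk1
  · have : {θ | k ≤ cos θ} ∩ Set.Ioo (-π) π = Set.Icc (-arccos k) (arccos k) := by
      ext θ
      have hlt : arccos k < π := by
        have := arccos_le_pi_div_two.2 hk
        linarith [pi_pos]
      have key : |θ| ≤ π → (k ≤ cos θ ↔ |θ| ≤ arccos k) := fun h => by
        rw [← cos_abs θ]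
        conv_lhs => rw [← cos_arccos (by linarith) hk1]
        exact strictAntiOn_cos.le_iff_ge ⟨arccos_nonneg k, arccos_le_pi k⟩ ⟨abs_nonneg θ, h⟩
      rw [Set.mem_inter_iff, Set.mem_ofPred_eq, Set.mem_Ioo, Set.mem_Icc, ← abs_lt, ← abs_le]
      exact ⟨fun h => (key h.2.le).1 h.1, fun h => ⟨(key (h.trans hlt.le)).2 h, h.trans_lt hlt⟩⟩
    rw [this, Real.volume_Icc]
    ring_nf
  · have : {θ | k ≤ cos θ} = ∅ := by
      ext θ
      simpa using (cos_le_one θ).trans_lt hk1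
    simp [this, arccos_of_one_le hk1.le]

theorem Complex.norm_polarCoord_symm_sub_ofReal_le_iff {D u r : ℝ} (hD : 0 ≤ D) (hu : 0 < u)
    (hr : 0 < r) (θ : ℝ) :
    ‖Complex.polarCoord.symm (r, θ) - u‖ ≤ D ↔
      (u ^ 2 + r ^ 2 - D ^ 2) / (2 * u * r) ≤ Real.cos θ := by
  have hsq : ‖Complex.polarCoord.symm (r, θ) - u‖ ^ 2 =
      u ^ 2 + r ^ 2 - Real.cos θ * (2 * u * r) := by
    rw [← Complex.normSq_eq_norm_sq, Complex.normSq_apply, Complex.polarCoord_symm_apply]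
    simp only [Complex.sub_re, Complex.sub_im, Complex.mul_re, Complex.mul_im, Complex.add_re,
      Complex.add_im, Complex.ofReal_re, Complex.ofReal_im, Complex.I_re, Complex.I_im]
    linear_combination r ^ 2 * Real.sin_sq_add_cos_sq θ
  rw [← sq_le_sq₀ (norm_nonneg _) hD, hsq, div_le_iff₀ (by positivity)]
  constructor <;> intro h <;> linarith

theorem Complex.setLIntegral_norm_closedBall (D : ℝ) {g : ℝ → ℝ≥0∞} (hg : Measurable g) :
    ∫⁻ z in {z : ℂ | ‖z‖ ≤ D}, g ‖z‖ =
      ENNReal.ofReal (2 * π) * ∫⁻ r in Set.Ioc 0 D, g r * ENNReal.ofReal r := by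
  rw [Complex.setLIntegral_norm_eq_lintegral_angle
      (measurableSet_le measurable_norm measurable_const) hg,
    ← lintegral_const_mul _ (by fun_prop), ← lintegral_indicator measurableSet_Ioi,
    ← lintegral_indicator measurableSet_Ioc]
  refine lintegral_congr fun r => ?_
  by_cases hr : 0 < r
  · by_cases hrD : r ≤ D
    · simp [Set.indicator, hr, hrD, Complex.norm_polarCoord_symm, abs_of_pos hr,
        -Complex.polarCoord_symm_apply, ← two_mul, ENNReal.ofReal_mul]
      ring
    · simp [Set.indicator, hr, hrD, Complex.norm_polarCoord_symm, abs_of_pos hr,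
        -Complex.polarCoord_symm_apply]
  · simp [Set.indicator, hr]

theorem Complex.measurableSet_lens (D u : ℝ) :
    MeasurableSet {z : ℂ | ‖z‖ ≤ D ∧ ‖z - u‖ ≤ D} :=
  (measurableSet_le measurable_norm measurable_const).inter
    (measurableSet_le (measurable_id.sub_const _).norm measurable_const)

theorem Complex.setLIntegral_norm_lens {D u : ℝ} (hD : 0 < D) (huD : D ≤ u)
    {g : ℝ → ℝ≥0∞} (hg : Measurable g) :
    ∫⁻ z in {z : ℂ | ‖z‖ ≤ D ∧ ‖z - u‖ ≤ D}, g ‖z‖ =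
      2 * ∫⁻ r in Set.Ioc (u - D) D, g r * ENNReal.ofReal
        (arccos ((u ^ 2 + r ^ 2 - D ^ 2) / (2 * u * r)) * r) := by
  have hu : 0 < u := hD.trans_le huD
  rw [Complex.setLIntegral_norm_eq_lintegral_angle (Complex.measurableSet_lens D u) hg,
    ← lintegral_const_mul _ (by fun_prop), ← lintegral_indicator measurableSet_Ioi,
    ← lintegral_indicator measurableSet_Ioc]
  refine lintegral_congr fun r => ?_
  by_cases hr : 0 < r
  · by_cases hrD : r ≤ D
    · have hk : 0 ≤ (u ^ 2 + r ^ 2 - D ^ 2) / (2 * u * r) := by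
        have := pow_le_pow_left₀ hD.le huD 2
        exact div_nonneg (by nlinarith [sq_nonneg r]) (by positivity)
      have hset : (fun θ => Complex.polarCoord.symm (r, θ)) ⁻¹'
          {z : ℂ | ‖z‖ ≤ D ∧ ‖z - u‖ ≤ D} =
          {θ | (u ^ 2 + r ^ 2 - D ^ 2) / (2 * u * r) ≤ Real.cos θ} := by
        ext θ
        simp only [Set.mem_preimage, Set.mem_ofPred_eq, Complex.norm_polarCoord_symm,
          abs_of_pos hr, hrD, true_and,
          Complex.norm_polarCoord_symm_sub_ofReal_le_iff hD.le hu hr]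
      rw [Set.indicator_of_mem (Set.mem_Ioi.2 hr)]
      simp only [hset]
      rw [Real.volume_le_cos_inter_Ioo hk]
      by_cases hru : u - D < r
      · rw [Set.indicator_of_mem (Set.mem_Ioc.2 ⟨hru, hrD⟩),
          ENNReal.ofReal_mul (arccos_nonneg _), ENNReal.ofReal_mul zero_le_two,
          ENNReal.ofReal_ofNat]
        ring
      · rw [Set.indicator_of_notMem fun h => hru h.1, arccos_of_one_le]
        · simp
        · rw [le_div_iff₀ (by positivity)]
          nlinarith
    · simp [Set.indicator, hr, hrD, Complex.norm_polarCoord_symm, abs_of_pos hr,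
        -Complex.polarCoord_symm_apply]
  · have : ¬ u - D < r := by linarith
    simp [Set.indicator, hr, this]

/-- Every nonzero point of the Euclidean plane is the image of its norm under some linear isometry
from `ℂ`. -/
theorem EuclideanSpace.exists_linearIsometryEquiv_complex {y : EuclideanSpace ℝ (Fin 2)}
    (hy : y ≠ 0) : ∃ φ : ℂ ≃ₗᵢ[ℝ] EuclideanSpace ℝ (Fin 2), φ (‖y‖ : ℂ) = y := by
  set e := Complex.orthonormalBasisOneI.repr
  have hn : (‖y‖ : ℂ) ≠ 0 := by simpa using hy
  obtain ⟨c, hc⟩ : ∃ c : Circle, (c : ℂ) = e.symm y / (‖y‖ : ℂ) :=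
    ⟨⟨_, mem_sphere_zero_iff_norm.2 (by simp [hy])⟩, rfl⟩
  refine ⟨(rotation c).trans e, ?_⟩
  rw [LinearIsometryEquiv.trans_apply, rotation_apply, hc, div_mul_cancel₀ _ hn, e.apply_symm_apply]

/-- For `D > 0`, `y₀ ∈ ℝ²` with `D ≤ u := ‖y₀‖ < 2D`, and measurable
`g : (0,∞) → [0,∞]`,
`∫_{‖x‖ ≤ D, ‖x - y₀‖ > D} g(‖x‖) dx
  = 2π ∫_0^D g(r) r dr - 2 ∫_{u-D}^{D} g(r) arccos ((u² + r² - D²)/(2 u r)) r dr`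
(stated in `ℝ≥0∞` in the equivalent, subtraction-free form
`LHS + 2 ∫_{u-D}^{D} g(r) arccos (…) r dr = 2π ∫_0^D g(r) r dr`). -/
theorem radial_integral_inside_ball_outside_ball_mid
    (D : ℝ) (hD : 0 < D) (y₀ : EuclideanSpace ℝ (Fin 2))
    (huD : D ≤ ‖y₀‖) (hu2D : ‖y₀‖ < 2 * D)
    (g : ℝ → ℝ≥0∞) (hg : Measurable g) :
    (∫⁻ x in {x : EuclideanSpace ℝ (Fin 2) | ‖x‖ ≤ D ∧ D < ‖x - y₀‖}, g ‖x‖) +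
      2 * ∫⁻ r in Set.Ioc (‖y₀‖ - D) D,
        g r * ENNReal.ofReal
          (Real.arccos ((‖y₀‖ ^ 2 + r ^ 2 - D ^ 2) / (2 * ‖y₀‖ * r)) * r) =
      ENNReal.ofReal (2 * Real.pi) * ∫⁻ r in Set.Ioc 0 D, g r * ENNReal.ofReal r := by
  obtain ⟨φ, hφ⟩ := EuclideanSpace.exists_linearIsometryEquiv_complex
    (norm_pos_iff.1 (hD.trans_le huD))
  have hS : MeasurableSet {x : EuclideanSpace ℝ (Fin 2) | ‖x‖ ≤ D ∧ D < ‖x - y₀‖} :=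
    (measurableSet_le measurable_norm measurable_const).inter
      (measurableSet_lt measurable_const (measurable_id.sub_const _).norm)
  have hpre : φ ⁻¹' {x | ‖x‖ ≤ D ∧ D < ‖x - y₀‖} =
      {z : ℂ | ‖z‖ ≤ D ∧ D < ‖z - (‖y₀‖ : ℝ)‖} := by
    ext z
    have : ‖φ z - y₀‖ = ‖z - (‖y₀‖ : ℝ)‖ := by
      rw [← φ.norm_map (z - (‖y₀‖ : ℝ)), map_sub, hφ]
    simp [this]
  have hLHS : ∫⁻ x in {x : EuclideanSpace ℝ (Fin 2) | ‖x‖ ≤ D ∧ D < ‖x - y₀‖}, g ‖x‖ =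
      ∫⁻ z in {z : ℂ | ‖z‖ ≤ D ∧ D < ‖z - (‖y₀‖ : ℝ)‖}, g ‖z‖ := by
    rw [← hpre, ← φ.measurePreserving.setLIntegral_comp_preimage (f := fun x => g ‖x‖) hS
      (hg.comp measurable_norm)]
    simp only [φ.norm_map]
  rw [hLHS, ← Complex.setLIntegral_norm_lens hD huD hg, ← Complex.setLIntegral_norm_closedBall D hg,
    ← lintegral_union]
  · congr 2
    ext z
    simp only [Set.mem_union, Set.mem_ofPred_eq, ← and_or_left, lt_or_ge, and_true]
  · exact Complex.measurableSet_lens D ‖y₀‖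
  · exact Set.disjoint_left.2 fun z hz hz' => hz.2.not_ge hz'.2
end

section
/- Let D > 0, let v₁, v₂ be real numbers with 0 < v₁ ≤ v₂ < 2D, let e ∈ ℝ² be a unit vector, and let g : (0, ∞) → [0, ∞) be measurable. Then ∫_{{x ∈ ℝ² : v₂/2 ≤ ‖x‖ ≤ D, ⟨x, e⟩ < v₁/2}} g(‖x‖) dx = 2·∫_{v₂/2}^{D} g(r)·(π − arccos(v₁/(2r)))·r dr. -/
open MeasureTheory Real
open scoped ENNReal RealInnerProductSpace

theorem exists_linearIsometryEquiv_complex_apply_one_eq {F : Type*} [NormedAddCommGroup F]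
    [InnerProductSpace ℝ F] [FiniteDimensional ℝ F] (hF : Module.finrank ℝ F = 2)
    {e : F} (he : ‖e‖ = 1) : ∃ φ : ℂ ≃ₗᵢ[ℝ] F, φ 1 = e := by
  have horth : Orthonormal ℝ (({0} : Set (Fin 2)).domRestrict fun _ => e) :=
    ⟨fun _ => he, fun i j hij => absurd (Subsingleton.elim i j) hij⟩
  obtain ⟨b, hb⟩ := horth.exists_orthonormalBasis_extension_of_card_eq (hF.trans (Fintype.card_fin 2).symm)
  exact ⟨Complex.isometryOfOrthonormal b, by
    simp [Complex.isometryOfOrthonormal_apply, hb 0 rfl]⟩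

theorem Real.cos_lt_iff_arccos_lt_abs {c θ : ℝ} (hc : c ∈ Set.Icc (-1) 1) (hθ : |θ| ≤ π) :
    cos θ < c ↔ arccos c < |θ| := by
  rw [← Real.cos_abs]
  have h := Real.strictAntiOn_arccos.lt_iff_gt hc
    ⟨Real.neg_one_le_cos |θ|, Real.cos_le_one |θ|⟩
  rwa [Real.arccos_cos (abs_nonneg θ) hθ, iff_comm] at h

theorem Real.volume_setOf_cos_lt {c : ℝ} (hc : c ∈ Set.Icc (-1) 1) :
    volume ({θ | cos θ < c} ∩ Set.Ioo (-π) π) = 2 * ENNReal.ofReal (π - arccos c) := by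
  have hset : {θ | cos θ < c} ∩ Set.Ioo (-π) π =
      Set.Ioo (-π) (-arccos c) ∪ Set.Ioo (arccos c) π := by
    ext θ
    have h₀ := arccos_nonneg c
    have hπ := arccos_le_pi c
    simp only [Set.mem_inter_iff, Set.mem_ofPred_eq, Set.mem_union, Set.mem_Ioo]
    constructor
    · rintro ⟨h, h₁, h₂⟩
      rw [cos_lt_iff_arccos_lt_abs hc (abs_le.2 ⟨h₁.le, h₂.le⟩), lt_abs] at h
      grind
    · intro h
      have h' : -π < θ ∧ θ < π := by grind
      refine ⟨?_, h'⟩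
      rw [cos_lt_iff_arccos_lt_abs hc (abs_le.2 ⟨h'.1.le, h'.2.le⟩), lt_abs]
      grind
  have hdisj : Disjoint (Set.Ioo (-π) (-arccos c)) (Set.Ioo (arccos c) π) :=
    Set.disjoint_left.2 fun θ h₁ h₂ => by linarith [h₁.2, h₂.1, arccos_nonneg c]
  rw [hset, measure_union hdisj measurableSet_Ioo, Real.volume_Ioo, Real.volume_Ioo,
    neg_sub_neg, two_mul]

theorem Complex.lintegral_eq_lintegral_polarCoord {f : ℂ → ℝ≥0∞} (hf : Measurable f) :
    ∫⁻ z, f z = ∫⁻ r in Set.Ioi 0, ENNReal.ofReal r *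
      ∫⁻ θ in Set.Ioo (-π) π, f (Complex.polarCoord.symm (r, θ)) := by
  have hsymm : Measurable fun p : ℝ × ℝ => Complex.polarCoord.symm p := by
    simp only [Complex.polarCoord_symm_apply]
    fun_prop
  have hm : Measurable fun p : ℝ × ℝ => f (Complex.polarCoord.symm p) := hf.comp hsymm
  rw [← Complex.lintegral_comp_polarCoord_symm, polarCoord_target, Measure.volume_eq_prod,
    ← Measure.prod_restrict]
  simp only [smul_eq_mul]
  rw [lintegral_prod _ (by fun_prop)]
  exact lintegral_congr fun r => lintegral_const_mul (ENNReal.ofReal r) (by fun_prop)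

/-- For `D > 0`, `0 < v₁ ≤ v₂ < 2D`, a unit vector `e ∈ ℝ²` and measurable
`g : (0,∞) → [0,∞]`,
`∫_{v₂/2 ≤ ‖x‖ ≤ D, ⟪x, e⟫ < v₁/2} g(‖x‖) dx
  = 2 ∫_{v₂/2}^{D} g(r) (π - arccos (v₁/(2r))) r dr`. -/
theorem radial_integral_annulus_near_side
    (D v₁ v₂ : ℝ) (hD : 0 < D) (hv₁ : 0 < v₁) (hv₁₂ : v₁ ≤ v₂) (hv₂ : v₂ < 2 * D)
    (e : EuclideanSpace ℝ (Fin 2)) (he : ‖e‖ = 1)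
    (g : ℝ → ℝ≥0∞) (hg : Measurable g) :
    ∫⁻ x in {x : EuclideanSpace ℝ (Fin 2) |
        (v₂ / 2 ≤ ‖x‖ ∧ ‖x‖ ≤ D) ∧ ⟪x, e⟫ < v₁ / 2}, g ‖x‖ =
      2 * ∫⁻ r in Set.Ioc (v₂ / 2) D,
        g r * ENNReal.ofReal ((Real.pi - Real.arccos (v₁ / (2 * r))) * r) := by
  obtain ⟨φ, rfl⟩ := exists_linearIsometryEquiv_complex_apply_one_eq (by simp) he
  have hv₂_pos : 0 < v₂ := hv₁.trans_le hv₁₂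
  set S : Set ℂ := {z | (v₂ / 2 ≤ ‖z‖ ∧ ‖z‖ ≤ D) ∧ z.re < v₁ / 2} with hS
  have hpre : φ ⁻¹' {x | (v₂ / 2 ≤ ‖x‖ ∧ ‖x‖ ≤ D) ∧ ⟪x, φ 1⟫ < v₁ / 2} = S := by
    ext z
    simp [hS, Complex.inner]
  have hSm : MeasurableSet S :=
    ((measurableSet_le measurable_const measurable_norm).inter
      (measurableSet_le measurable_norm measurable_const)).inter
      (measurableSet_lt Complex.measurable_re measurable_const)
  rw [← φ.measurePreserving.setLIntegral_comp_preimage_emb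
    φ.toHomeomorph.measurableEmbedding, hpre]
  simp only [φ.norm_map]
  rw [← lintegral_indicator hSm, Complex.lintegral_eq_lintegral_polarCoord
    (f := S.indicator fun z => g ‖z‖)
    ((hg.comp measurable_norm).indicator hSm), ← lintegral_const_mul' _ _ (by simp),
    setLIntegral_congr Ioc_ae_eq_Icc, ← lintegral_indicator measurableSet_Icc,
    ← lintegral_indicator measurableSet_Ioi]
  refine lintegral_congr fun r => ?_
  by_cases hr : r ∈ Set.Icc (v₂ / 2) D
  · have hr₀ : 0 < r := by linarith [hr.1]
    have hc : v₁ / (2 * r) ∈ Set.Icc (-1) 1 :=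
      ⟨by linarith [show 0 < v₁ / (2 * r) by positivity],
        (div_le_one (by positivity)).2 (by linarith [hr.1])⟩
    have hind (θ : ℝ) : S.indicator (fun z => g ‖z‖) (Complex.polarCoord.symm (r, θ)) =
        {θ | cos θ < v₁ / (2 * r)}.indicator (fun _ => g r) θ := by
      have hn : ‖Complex.polarCoord.symm (r, θ)‖ = r := by
        rw [Complex.norm_polarCoord_symm, abs_of_pos hr₀]
      have hre : (Complex.polarCoord.symm (r, θ)).re = r * cos θ := by
        simp [-Complex.ofReal_cos, -Complex.ofReal_sin]
      have hmem : Complex.polarCoord.symm (r, θ) ∈ S ↔ cos θ < v₁ / (2 * r) := by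
        rw [hS, Set.mem_ofPred_eq, hn, hre, and_iff_right (Set.mem_Icc.1 hr), ← div_div, lt_div_iff₀' hr₀]
      simp only [Set.indicator, hmem, hn, Set.mem_ofPred_eq]
    have hm : MeasurableSet {θ | cos θ < v₁ / (2 * r)} :=
      measurableSet_lt Real.measurable_cos measurable_const
    rw [Set.indicator_of_mem (Set.mem_Ioi.2 hr₀), Set.indicator_of_mem hr]
    simp only [hind]
    rw [lintegral_indicator_const hm, Measure.restrict_apply hm, Real.volume_setOf_cos_lt hc,
      ENNReal.ofReal_mul (sub_nonneg.2 (arccos_le_pi _))]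
    ring
  · rw [Set.indicator_of_notMem hr]
    refine Set.indicator_apply_eq_zero.2 fun hr₀ => ?_
    have hind (θ : ℝ) : S.indicator (fun z => g ‖z‖) (Complex.polarCoord.symm (r, θ)) = 0 := by
      refine Set.indicator_of_notMem (fun h => hr ?_) _
      have := h.1
      rwa [Complex.norm_polarCoord_symm, abs_of_pos hr₀] at this
    simp only [hind, lintegral_zero, mul_zero]
end

section
/- Let r₀ > 0 and r_e > 0 be real numbers, let Θ be a random variable uniformly distributed on [0, 2π), and define U = √(r₀² + r_e² − 2·r₀·r_e·cos Θ). Then the law of U is absolutely continuous with respect to Lebesgue measure, with density h(u) = 2u/(π·√(4·r₀²·r_e² − (r₀² + r_e² − u²)²)) for u in the open interval (|r₀ − r_e|, r₀ + r_e), and density 0 outside the closed interval [|r₀ − r_e|, r₀ + r_e]. -/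
open MeasureTheory Real

/-- The integral over a full period of a function of `cos θ` is twice the one over `(0, π)`. -/
theorem setLIntegral_Ico_comp_cos (G : ℝ → ENNReal) :
    ∫⁻ θ in Set.Ico 0 (2 * π), G (cos θ) = 2 * ∫⁻ θ in Set.Ioo 0 π, G (cos θ) := by
  have reflect : ∫⁻ θ in Set.Ioo π (2 * π), G (cos θ) = ∫⁻ θ in Set.Ioo 0 π, G (cos θ) := by
    have himg : (fun x : ℝ => 2 * π - x) '' Set.Ioo 0 π = Set.Ioo π (2 * π) := by
      rw [Set.image_const_sub_Ioo]
      congr 1 <;> ring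
    rw [← himg, lintegral_image_eq_lintegral_abs_deriv_mul (f := fun x => 2 * π - x) (f' := fun _ => -1)
      measurableSet_Ioo
      (fun x _ => ((hasDerivAt_id x).const_sub (2 * π)).hasDerivWithinAt)
      (fun x _ y _ h => by simpa using h)]
    simp [Real.cos_two_pi_sub]
  rw [← Set.Ico_union_Ico_eq_Ico pi_pos.le (by linarith [pi_pos] : π ≤ 2 * π),
    lintegral_union measurableSet_Ico Set.Ico_disjoint_Ico_same,
    setLIntegral_congr (Ioo_ae_eq_Ico (a := (0 : ℝ)) (b := π)).symm,
    setLIntegral_congr (Ioo_ae_eq_Ico (a := π) (b := 2 * π)).symm, reflect, two_mul]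

section LawOfCosines

variable {a b : ℝ}

theorem lawOfCosines_pos_of_mem_Ioo (ha : 0 < a) (hb : 0 < b) {θ : ℝ} (hθ : θ ∈ Set.Ioo 0 π) :
    0 < a ^ 2 + b ^ 2 - 2 * a * b * cos θ := by
  have hcos : cos θ < 1 := by
    simpa using cos_lt_cos_of_nonneg_of_le_pi le_rfl hθ.2.le hθ.1
  nlinarith [sq_nonneg (a - b), mul_pos ha hb]

theorem hasDerivAt_sqrt_lawOfCosines (ha : 0 < a) (hb : 0 < b) {θ : ℝ}
    (hθ : θ ∈ Set.Ioo 0 π) :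
    HasDerivAt (fun θ => √(a ^ 2 + b ^ 2 - 2 * a * b * cos θ))
      (a * b * sin θ / √(a ^ 2 + b ^ 2 - 2 * a * b * cos θ)) θ := by
  have hpos := lawOfCosines_pos_of_mem_Ioo ha hb hθ
  convert (((hasDerivAt_cos θ).const_mul (2 * a * b)).const_sub (a ^ 2 + b ^ 2)).sqrt
    hpos.ne' using 1
  have := (sqrt_pos.2 hpos).ne'
  field_simp

theorem injOn_sqrt_lawOfCosines (ha : 0 < a) (hb : 0 < b) :
    Set.InjOn (fun θ => √(a ^ 2 + b ^ 2 - 2 * a * b * cos θ)) (Set.Ioo 0 π) := by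
  intro x hx y hy hxy
  have h := (sqrt_inj (lawOfCosines_pos_of_mem_Ioo ha hb hx).le
    (lawOfCosines_pos_of_mem_Ioo ha hb hy).le).1 hxy
  have hab : 2 * a * b ≠ 0 := by positivity
  exact injOn_cos (Set.Ioo_subset_Icc_self hx) (Set.Ioo_subset_Icc_self hy)
    (mul_left_cancel₀ hab (by linarith))

theorem image_sqrt_lawOfCosines (ha : 0 < a) (hb : 0 < b) :
    (fun θ => √(a ^ 2 + b ^ 2 - 2 * a * b * cos θ)) '' Set.Ioo 0 π =
      Set.Ioo |a - b| (a + b) := by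
  have hab : 0 < a * b := mul_pos ha hb
  ext u
  constructor
  · rintro ⟨θ, hθ, rfl⟩
    have h1 : cos θ < 1 := by
      simpa using cos_lt_cos_of_nonneg_of_le_pi le_rfl hθ.2.le hθ.1
    have h2 : -1 < cos θ := by
      simpa using cos_lt_cos_of_nonneg_of_le_pi hθ.1.le le_rfl hθ.2
    constructor
    · apply lt_sqrt_of_sq_lt
      rw [sq_abs]
      nlinarith
    · rw [sqrt_lt' (by positivity)]
      nlinarith
  · rintro ⟨h1, h2⟩
    have hu : 0 < u := (abs_nonneg _).trans_lt h1
    have h1' : (a - b) ^ 2 < u ^ 2 := sq_lt_sq.2 (by rwa [abs_of_pos hu])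
    have h2' : u ^ 2 < (a + b) ^ 2 := by gcongr
    have hlt : (a ^ 2 + b ^ 2 - u ^ 2) / (2 * a * b) < 1 := by
      rw [div_lt_one (by positivity)]
      linarith
    have hgt : -1 < (a ^ 2 + b ^ 2 - u ^ 2) / (2 * a * b) := by
      rw [lt_div_iff₀ (by positivity)]
      linarith
    refine ⟨arccos ((a ^ 2 + b ^ 2 - u ^ 2) / (2 * a * b)),
      ⟨arccos_pos.2 hlt, arccos_lt_pi.2 hgt⟩, ?_⟩
    simp only
    rw [cos_arccos hgt.le hlt.le, mul_div_cancel₀ _ (by positivity), sub_sub_cancel,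
      sqrt_sq hu.le]

/-- The Jacobian of `θ ↦ √(a² + b² - 2ab cos θ)` times the density of its law is constant. -/
theorem deriv_mul_density_lawOfCosines (ha : 0 < a) (hb : 0 < b) {θ : ℝ}
    (hθ : θ ∈ Set.Ioo 0 π) :
    |a * b * sin θ / √(a ^ 2 + b ^ 2 - 2 * a * b * cos θ)| *
      (2 * √(a ^ 2 + b ^ 2 - 2 * a * b * cos θ) /
        (π * √(4 * a ^ 2 * b ^ 2 -
          (a ^ 2 + b ^ 2 - √(a ^ 2 + b ^ 2 - 2 * a * b * cos θ) ^ 2) ^ 2))) = π⁻¹ := by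
  have hpos := lawOfCosines_pos_of_mem_Ioo ha hb hθ
  have hsin := sin_pos_of_mem_Ioo hθ
  have hden : 4 * a ^ 2 * b ^ 2 -
      (a ^ 2 + b ^ 2 - √(a ^ 2 + b ^ 2 - 2 * a * b * cos θ) ^ 2) ^ 2 =
      (2 * (a * b * sin θ)) ^ 2 := by
    rw [sq_sqrt hpos.le, mul_pow 2, mul_pow _ (sin θ), sin_sq]
    ring
  have hs := sqrt_pos.2 hpos
  rw [hden, sqrt_sq (by positivity), abs_of_pos (by positivity)]
  generalize √(a ^ 2 + b ^ 2 - 2 * a * b * cos θ) = s at hs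
  field_simp

end LawOfCosines

/-- Let `r₀, r_e > 0`, let `Θ` be uniformly distributed on `[0, 2π)`, and set
`U = √(r₀² + r_e² - 2 r₀ r_e cos Θ)`. Then the law of `U` is absolutely continuous w.r.t.
Lebesgue measure with density `h(u) = 2u/(π √(4 r₀² r_e² - (r₀² + r_e² - u²)²))` on the open
interval `(|r₀ - r_e|, r₀ + r_e)` and density `0` outside it. -/
theorem law_of_cosines_distance_pdf
    (r₀ re : ℝ) (hr₀ : 0 < r₀) (hre : 0 < re)
    {Ω : Type*} [MeasurableSpace Ω] (μ : Measure Ω) [IsProbabilityMeasure μ]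
    (Θ : Ω → ℝ) (hΘ : Measurable Θ)
    (hunif : μ.map Θ =
      (volume (Set.Ico (0 : ℝ) (2 * Real.pi)))⁻¹ • volume.restrict (Set.Ico 0 (2 * Real.pi))) :
    μ.map (fun ω => Real.sqrt (r₀ ^ 2 + re ^ 2 - 2 * r₀ * re * Real.cos (Θ ω))) =
      volume.withDensity (fun u =>
        if |r₀ - re| < u ∧ u < r₀ + re then
          ENNReal.ofReal
            (2 * u / (Real.pi * Real.sqrt (4 * r₀ ^ 2 * re ^ 2 - (r₀ ^ 2 + re ^ 2 - u ^ 2) ^ 2)))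
        else 0) := by
  have hf : Measurable fun θ : ℝ => √(r₀ ^ 2 + re ^ 2 - 2 * r₀ * re * cos θ) := by fun_prop
  refine (Measure.map_map hf hΘ).symm.trans ?_
  rw [hunif]
  ext A hA
  rw [Measure.map_apply hf hA, withDensity_apply _ hA, Measure.smul_apply, smul_eq_mul,
    ← lintegral_indicator_one (hf hA)]
  have hcos := setLIntegral_Ico_comp_cos
    (fun c => A.indicator 1 √(r₀ ^ 2 + re ^ 2 - 2 * r₀ * re * c))
  change _ * ∫⁻ θ in Set.Ico 0 (2 * π),
    A.indicator 1 √(r₀ ^ 2 + re ^ 2 - 2 * r₀ * re * cos θ) = _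
  rw [hcos, ← lintegral_indicator hA]
  let h : ℝ → ENNReal := fun u => ENNReal.ofReal
    (2 * u / (π * √(4 * r₀ ^ 2 * re ^ 2 - (r₀ ^ 2 + re ^ 2 - u ^ 2) ^ 2)))
  have hright : (A.indicator fun u => if |r₀ - re| < u ∧ u < r₀ + re then h u else 0) =
      (Set.Ioo |r₀ - re| (r₀ + re)).indicator fun u => h u * A.indicator 1 u := by
    ext u
    by_cases hu : u ∈ A <;> simp [Set.indicator_apply, hu]
  change _ = ∫⁻ u, (A.indicator fun u => if |r₀ - re| < u ∧ u < r₀ + re then h u else 0) u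
  rw [hright, lintegral_indicator measurableSet_Ioo, ← image_sqrt_lawOfCosines hr₀ hre,
    lintegral_image_eq_lintegral_abs_deriv_mul measurableSet_Ioo
      (fun θ hθ => (hasDerivAt_sqrt_lawOfCosines hr₀ hre hθ).hasDerivWithinAt)
      (injOn_sqrt_lawOfCosines hr₀ hre)]
  have hconst : ∀ θ ∈ Set.Ioo 0 π,
      ENNReal.ofReal |r₀ * re * sin θ / √(r₀ ^ 2 + re ^ 2 - 2 * r₀ * re * cos θ)| *
        (h √(r₀ ^ 2 + re ^ 2 - 2 * r₀ * re * cos θ) *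
          A.indicator 1 √(r₀ ^ 2 + re ^ 2 - 2 * r₀ * re * cos θ)) =
      ENNReal.ofReal π⁻¹ * A.indicator 1 √(r₀ ^ 2 + re ^ 2 - 2 * r₀ * re * cos θ) := by
    intro θ hθ
    rw [← mul_assoc, ← ENNReal.ofReal_mul (abs_nonneg _),
      deriv_mul_density_lawOfCosines hr₀ hre hθ]
  rw [setLIntegral_congr_fun measurableSet_Ioo hconst,
    lintegral_const_mul' _ _ ENNReal.ofReal_ne_top, ← mul_assoc]
  congr 1
  rw [Real.volume_Ico, sub_zero, ← ENNReal.ofReal_inv_of_pos (by positivity),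
    ← ENNReal.ofReal_ofNat 2, ← ENNReal.ofReal_mul (by positivity)]
  congr 1
  field_simp
end
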